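/- Let Φ = Φ₁ + Φ₂i₂ : U → 𝔹 be a holomorphic map on an open set U ⊆ ℂ^m (viewing 𝔹 = ℂ²). Then Φ is a complex-harmonic morphism if and only if (a) Σ_{k=1}^m ∂²Φ/∂z_k² = 0 and (b) Σ_{k=1}^m (∂Φ/∂z_k)² = 0, where the derivatives are taken componentwise and the squares are taken in 𝔹; equivalently, if and only if Δ_ℂΦ₁ = Δ_ℂΦ₂ = 0, (grad_ℂΦ₁)² = (grad_ℂΦ₂)², and ⟨grad_ℂΦ₁, grad_ℂΦ₂⟩_ℂ = 0. -/

import Mathlib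

noncomputable section

/-- Bicomplex multiplication on `𝔹 = ℂ × ℂ`. -/
def bmul (q w : ℂ × ℂ) : ℂ × ℂ := (q.1 * w.1 - q.2 * w.2, q.1 * w.2 + q.2 * w.1)

/-- Complex (square) norm of a bicomplex number. -/
def bN (q : ℂ × ℂ) : ℂ := q.1 ^ 2 + q.2 ^ 2

/-- Complex Laplacian of `f : ℂ^m → ℂ`. -/
def lapC {m : ℕ} (f : (Fin m → ℂ) → ℂ) (p : Fin m → ℂ) : ℂ :=
  ∑ k, fderiv ℂ (fun z => fderiv ℂ f z (Pi.single k 1)) p (Pi.single k 1)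

/-- Complex gradient of `f : ℂ^m → ℂ`. -/
def gradC {m : ℕ} (f : (Fin m → ℂ) → ℂ) (p : Fin m → ℂ) : Fin m → ℂ :=
  fun k => fderiv ℂ f p (Pi.single k 1)

/-- Complex-bilinear inner product on `ℂ^m`. -/
def innC {m : ℕ} (u v : Fin m → ℂ) : ℂ := ∑ k, u k * v k

/-- Complex-harmonic (holomorphic) function on an open set `V ⊆ ℂ^m`. -/
def ComplexHarmonicOn {m : ℕ} (f : (Fin m → ℂ) → ℂ) (V : Set (Fin m → ℂ)) : Prop :=
  DifferentiableOn ℂ f V ∧ ∀ p ∈ V, lapC f p = 0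

/-- Complex Laplacian of `f : ℂ² → ℂ` (coordinates `q₁, q₂` on `𝔹 = ℂ²`). -/
def lapB (f : ℂ × ℂ → ℂ) (p : ℂ × ℂ) : ℂ :=
  fderiv ℂ (fun w => fderiv ℂ f w ((1 : ℂ), (0 : ℂ))) p ((1 : ℂ), (0 : ℂ)) +
  fderiv ℂ (fun w => fderiv ℂ f w ((0 : ℂ), (1 : ℂ))) p ((0 : ℂ), (1 : ℂ))

/-- Complex-harmonic function on an open set `V ⊆ ℂ² = 𝔹`. -/
def ComplexHarmonicOnB (f : ℂ × ℂ → ℂ) (V : Set (ℂ × ℂ)) : Prop :=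
  DifferentiableOn ℂ f V ∧ ∀ p ∈ V, lapB f p = 0

/-- Complex-harmonic morphism `ℂ^m ⊇ U → ℂ² = 𝔹`: pulls back complex-harmonic
functions on open subsets of `ℂ²` to complex-harmonic functions. -/
def IsCHMB {m : ℕ} (Φ : (Fin m → ℂ) → ℂ × ℂ) (U : Set (Fin m → ℂ)) : Prop :=
  ∀ V : Set (ℂ × ℂ), IsOpen V → ∀ f : ℂ × ℂ → ℂ,
    ComplexHarmonicOnB f V → (U ∩ Φ ⁻¹' V).Nonempty →
      ComplexHarmonicOn (f ∘ Φ) (U ∩ Φ ⁻¹' V)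

/-- The bicomplex gradient `grad_ℂ Φ ∈ 𝔹^m` of `Φ : ℂ^m → 𝔹`. -/
def gradB {m : ℕ} (Φ : (Fin m → ℂ) → ℂ × ℂ) (p : Fin m → ℂ) : Fin m → ℂ × ℂ :=
  fun k => (fderiv ℂ (fun z => (Φ z).1) p (Pi.single k 1),
            fderiv ℂ (fun z => (Φ z).2) p (Pi.single k 1))

open Metric Set Topology

/-- Cauchy's integral formula for a directional derivative of a holomorphic function. -/
theorem fderiv_apply_eq_integral_circleMap {E : Type*} [NormedAddCommGroup E] [NormedSpace ℂ E]
    {f : E → ℂ} {z v : E} {ρ : ℝ} (hρ : 0 < ρ)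
    (hf : ∀ ζ ∈ closedBall (0 : ℂ) ρ, DifferentiableAt ℂ f (z + ζ • v)) :
    fderiv ℂ f z v = (2 * Real.pi * Complex.I)⁻¹ * ∫ θ in (0 : ℝ)..2 * Real.pi,
      circleMap 0 ρ θ * Complex.I * (1 / (circleMap 0 ρ θ - 0) ^ 2) *
        f (z + circleMap 0 ρ θ • v) := by
  have hline : DifferentiableOn ℂ (fun ζ : ℂ => f (z + ζ • v)) (closedBall 0 ρ) :=
    fun ζ hζ => ((hf ζ hζ).comp ζ (by fun_prop)).differentiableWithinAt
  have hderiv : deriv (fun ζ : ℂ => f (z + ζ • v)) 0 = fderiv ℂ f z v := by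
    have hd : HasDerivAt (fun ζ : ℂ => z + ζ • v) v 0 := by
      simpa using ((hasDerivAt_id (0 : ℂ)).smul_const v).const_add z
    simpa [Function.comp_def] using
      ((hf 0 (by simpa using hρ.le)).hasFDerivAt.comp_hasDerivAt (0 : ℂ) hd).deriv
  have key := hline.deriv_eq_smul_circleIntegral hρ
  rw [hderiv, circleIntegral] at key
  rw [eq_inv_mul_iff_mul_eq₀ Complex.two_pi_I_ne_zero]
  simpa only [deriv_circleMap, smul_eq_mul, ← mul_assoc] using key.symm

/-- The derivative of a holomorphic function is locally bounded. -/
theorem exists_ball_norm_fderiv_le {E : Type*} [NormedAddCommGroup E] [NormedSpace ℂ E]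
    {f : E → ℂ} {U : Set E} (hf : DifferentiableOn ℂ f U) (hU : IsOpen U) {x₀ : E}
    (hx₀ : x₀ ∈ U) : ∃ R > 0, ball x₀ R ⊆ U ∧ ∀ x ∈ ball x₀ R, ‖fderiv ℂ f x‖ ≤ 2 / R := by
  have hc : ContinuousAt f x₀ := (hf.differentiableAt (hU.mem_nhds hx₀)).continuousAt
  obtain ⟨r, hr, h⟩ := Metric.mem_nhds_iff.1 (Filter.inter_mem (hU.mem_nhds hx₀)
    (hc.preimage_mem_nhds (ball_mem_nhds (f x₀) one_pos)))
  refine ⟨r / 2, by positivity,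
    fun x hx => (h (ball_subset_ball (by linarith) hx)).1, fun x hx => ?_⟩
  have hsub : ball x (r / 2) ⊆ ball x₀ r :=
    ball_subset_ball' (by rw [mem_ball] at hx; linarith)
  refine Complex.norm_fderiv_le_div_of_mapsTo_ball (hf.mono fun y hy => (h (hsub hy)).1) ?_
    (half_pos hr)
  intro y hy
  have h₁ := (h (hsub hy)).2
  have h₂ := (h (hsub (mem_ball_self (half_pos hr)))).2
  rw [mem_preimage, mem_ball] at h₁ h₂
  rw [mem_closedBall]
  linarith [dist_triangle_right (f y) (f x) (f x₀)]

/-- The directional derivatives of a holomorphic function of several variables are holomorphic. -/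
theorem differentiableOn_fderiv_apply {E : Type*} [NormedAddCommGroup E]
    [NormedSpace ℂ E] [FiniteDimensional ℂ E] {f : E → ℂ} {U : Set E}
    (hf : DifferentiableOn ℂ f U) (hU : IsOpen U) (v : E) :
    DifferentiableOn ℂ (fun z => fderiv ℂ f z v) U := by
  intro x₀ hx₀
  borelize E
  borelize (E →L[ℂ] ℂ)
  obtain ⟨R, hR, hRU, hbound⟩ := exists_ball_norm_fderiv_le hf hU hx₀
  obtain ⟨ρ, hρ, hρv⟩ : ∃ ρ > 0, ρ * ‖v‖ < R / 2 :=
    ⟨R / 2 / (‖v‖ + 1), by positivity, by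
      rw [div_mul_eq_mul_div, div_lt_iff₀ (by positivity)]; nlinarith⟩
  have hmem : ∀ z ∈ ball x₀ (R / 2), ∀ ζ ∈ closedBall (0 : ℂ) ρ, z + ζ • v ∈ ball x₀ R := by
    intro z hz ζ hζ
    rw [mem_ball, dist_eq_norm] at hz ⊢
    rw [mem_closedBall_zero_iff] at hζ
    calc ‖z + ζ • v - x₀‖ = ‖(z - x₀) + ζ • v‖ := by congr 1; abel
      _ ≤ ‖z - x₀‖ + ‖ζ‖ * ‖v‖ := (norm_add_le _ _).trans_eq (by rw [norm_smul])
      _ < R := by nlinarith [mul_le_mul_of_nonneg_right hζ (norm_nonneg v)]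
  have hdiff : ∀ x ∈ ball x₀ R, DifferentiableAt ℂ f x := fun x hx =>
    hf.differentiableAt (hU.mem_nhds (hRU hx))
  have hcircle : ∀ θ : ℝ, circleMap (0 : ℂ) ρ θ ∈ closedBall (0 : ℂ) ρ :=
    fun θ => circleMap_mem_closedBall _ hρ.le _
  obtain ⟨c, hc, hCauchy⟩ : ∃ c : ℝ → ℂ, Continuous c ∧ ∀ z ∈ ball x₀ (R / 2),
      fderiv ℂ f z v = (2 * Real.pi * Complex.I)⁻¹ *
        ∫ θ in (0 : ℝ)..2 * Real.pi, c θ * f (z + circleMap 0 ρ θ • v) := by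
    refine ⟨fun θ => circleMap 0 ρ θ * Complex.I * (1 / (circleMap 0 ρ θ - 0) ^ 2), ?_,
      fun z hz => fderiv_apply_eq_integral_circleMap hρ fun ζ hζ => hdiff _ (hmem z hz ζ hζ)⟩
    have hne : ∀ θ : ℝ, (circleMap 0 ρ θ - 0) ^ 2 ≠ 0 := fun θ => by simpa using hρ.ne'
    exact ((continuous_circleMap 0 ρ).mul continuous_const).mul (continuous_const.div₀
      (((continuous_circleMap 0 ρ).sub continuous_const).pow 2) hne)
  have hcont : ∀ z ∈ ball x₀ (R / 2),
      Continuous fun θ : ℝ => c θ * f (z + circleMap 0 ρ θ • v) := fun z hz => by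
    have hline : Continuous fun θ : ℝ => z + circleMap 0 ρ θ • v := by fun_prop
    exact hc.mul ((hf.continuousOn.mono hRU).comp_continuous hline
      fun θ => hmem z hz _ (hcircle θ))
  have hnhds : ball x₀ (R / 2) ∈ 𝓝 x₀ := ball_mem_nhds _ (by positivity)
  have hmeas : MeasureTheory.AEStronglyMeasurable
      (fun θ => c θ • fderiv ℂ f (x₀ + circleMap 0 ρ θ • v))
      (MeasureTheory.volume.restrict (uIoc 0 (2 * Real.pi))) := by
    have hline : Continuous fun θ : ℝ => x₀ + circleMap 0 ρ θ • v := by fun_prop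
    exact hc.aestronglyMeasurable.smul
      ((measurable_fderiv ℂ f).comp hline.measurable).aestronglyMeasurable
  have hbound' : ∀ θ : ℝ, ∀ z ∈ ball x₀ (R / 2),
      ‖c θ • fderiv ℂ f (z + circleMap 0 ρ θ • v)‖ ≤ ‖c θ‖ * (2 / R) := fun θ z hz => by
    rw [norm_smul]
    exact mul_le_mul_of_nonneg_left (hbound _ (hmem z hz _ (hcircle θ))) (norm_nonneg _)
  have hderiv : ∀ θ : ℝ, ∀ z ∈ ball x₀ (R / 2),
      HasFDerivAt (fun z => c θ * f (z + circleMap 0 ρ θ • v))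
        (c θ • fderiv ℂ f (z + circleMap 0 ρ θ • v)) z := fun θ z hz =>
    ((hasFDerivAt_comp_add_right _).2
      (hdiff _ (hmem z hz _ (hcircle θ))).hasFDerivAt).const_mul (c θ)
  have hint : HasFDerivAt
      (fun z => ∫ θ in (0 : ℝ)..2 * Real.pi, c θ * f (z + circleMap 0 ρ θ • v))
      (∫ θ in (0 : ℝ)..2 * Real.pi, c θ • fderiv ℂ f (x₀ + circleMap 0 ρ θ • v)) x₀ :=
    intervalIntegral.hasFDerivAt_integral_of_dominated_of_fderiv_le hnhds
      (Filter.eventually_of_mem hnhds fun z hz => (hcont z hz).aestronglyMeasurable)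
      ((hcont x₀ (mem_of_mem_nhds hnhds)).intervalIntegrable _ _) hmeas
      (.of_forall fun θ _ => hbound' θ)
      ((hc.norm.mul continuous_const).intervalIntegrable _ _)
      (.of_forall fun θ _ => hderiv θ)
  have heq := Filter.eventuallyEq_of_mem hnhds hCauchy
  have hdiffAt := hint.differentiableAt.const_mul (2 * Real.pi * Complex.I)⁻¹
  exact (hdiffAt.congr_of_eventuallyEq heq).differentiableWithinAt

/-- The chain rule for the complex Laplacian of a composition with a map into `ℂ²`. -/
theorem lapC_comp {m : ℕ} {U : Set (Fin m → ℂ)} (hU : IsOpen U) {Φ : (Fin m → ℂ) → ℂ × ℂ}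
    (hΦ : DifferentiableOn ℂ Φ U) {V : Set (ℂ × ℂ)} (hV : IsOpen V) {f : ℂ × ℂ → ℂ}
    (hf : DifferentiableOn ℂ f V) {p : Fin m → ℂ} (hp : p ∈ U) (hpV : Φ p ∈ V) :
    lapC (f ∘ Φ) p =
      fderiv ℂ (fun w => fderiv ℂ f w (1, 0)) (Φ p) (1, 0) *
          innC (gradC (fun z => (Φ z).1) p) (gradC (fun z => (Φ z).1) p) +
        fderiv ℂ (fun w => fderiv ℂ f w (0, 1)) (Φ p) (0, 1) *
          innC (gradC (fun z => (Φ z).2) p) (gradC (fun z => (Φ z).2) p) +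
        (fderiv ℂ (fun w => fderiv ℂ f w (1, 0)) (Φ p) (0, 1) +
            fderiv ℂ (fun w => fderiv ℂ f w (0, 1)) (Φ p) (1, 0)) *
          innC (gradC (fun z => (Φ z).1) p) (gradC (fun z => (Φ z).2) p) +
        fderiv ℂ f (Φ p) (1, 0) * lapC (fun z => (Φ z).1) p +
        fderiv ℂ f (Φ p) (0, 1) * lapC (fun z => (Φ z).2) p := by
  have hchain : ∀ {g : ℂ × ℂ → ℂ} {z : Fin m → ℂ}, DifferentiableOn ℂ g V → z ∈ U → Φ z ∈ V →
      ∀ e, fderiv ℂ (fun z => g (Φ z)) z e =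
        fderiv ℂ g (Φ z) (1, 0) * fderiv ℂ (fun z => (Φ z).1) z e +
          fderiv ℂ g (Φ z) (0, 1) * fderiv ℂ (fun z => (Φ z).2) z e := by
    intro g z hg hz hzV e
    have hΦz := hΦ.differentiableAt (hU.mem_nhds hz)
    have hgz := hg.differentiableAt (hV.mem_nhds hzV)
    have h₁ : fderiv ℂ (fun z => (Φ z).1) z e = (fderiv ℂ Φ z e).1 := by
      rw [fderiv.fst hΦz]; rfl
    have h₂ : fderiv ℂ (fun z => (Φ z).2) z e = (fderiv ℂ Φ z e).2 := by
      rw [fderiv.snd hΦz]; rfl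
    have h : fderiv ℂ (fun z => g (Φ z)) z = (fderiv ℂ g (Φ z)).comp (fderiv ℂ Φ z) :=
      fderiv_comp z hgz hΦz
    rw [h, h₁, h₂, ContinuousLinearMap.comp_apply]
    generalize fderiv ℂ Φ z e = q
    have hq : q = q.1 • ((1 : ℂ), (0 : ℂ)) + q.2 • ((0 : ℂ), (1 : ℂ)) := by ext <;> simp
    conv_lhs => rw [hq]
    simp only [map_add, map_smul, smul_eq_mul]
    ring
  have hW : IsOpen (U ∩ Φ ⁻¹' V) := hΦ.continuousOn.isOpen_inter_preimage hU hV
  have hΦp := hΦ.differentiableAt (hU.mem_nhds hp)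
  have hpart : ∀ v, DifferentiableOn ℂ (fun w => fderiv ℂ f w v) V :=
    differentiableOn_fderiv_apply hf hV
  have hpartp : ∀ v, DifferentiableAt ℂ (fun z => fderiv ℂ f (Φ z) v) p := fun v =>
    ((hpart v).differentiableAt (hV.mem_nhds hpV)).comp p hΦp
  have hcomp₁ : ∀ e, DifferentiableAt ℂ (fun z => fderiv ℂ (fun z => (Φ z).1) z e) p := fun e =>
    (differentiableOn_fderiv_apply hΦ.fst hU e).differentiableAt (hU.mem_nhds hp)
  have hcomp₂ : ∀ e, DifferentiableAt ℂ (fun z => fderiv ℂ (fun z => (Φ z).2) z e) p := fun e =>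
    (differentiableOn_fderiv_apply hΦ.snd hU e).differentiableAt (hU.mem_nhds hp)
  simp only [lapC, innC, gradC, Finset.mul_sum, ← Finset.sum_add_distrib]
  refine Finset.sum_congr rfl fun k _ => ?_
  set e : Fin m → ℂ := Pi.single k 1
  have hev : (fun z => fderiv ℂ (f ∘ Φ) z e) =ᶠ[nhds p] fun z =>
      fderiv ℂ f (Φ z) (1, 0) * fderiv ℂ (fun z => (Φ z).1) z e +
        fderiv ℂ f (Φ z) (0, 1) * fderiv ℂ (fun z => (Φ z).2) z e := by
    filter_upwards [hW.mem_nhds ⟨hp, hpV⟩] with z hz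
    exact hchain hf hz.1 hz.2 e
  rw [hev.fderiv_eq, fderiv_fun_add ((hpartp _).fun_mul (hcomp₁ e)) ((hpartp _).fun_mul (hcomp₂ e)),
    fderiv_fun_mul (hpartp _) (hcomp₁ e), fderiv_fun_mul (hpartp _) (hcomp₂ e)]
  simp only [add_apply, smul_apply, smul_eq_mul]
  rw [hchain (hpart (1, 0)) hp hpV e, hchain (hpart (0, 1)) hp hpV e]
  ring

theorem sum_bmul_gradB_self_eq_zero_iff {m : ℕ} (Φ : (Fin m → ℂ) → ℂ × ℂ) (p : Fin m → ℂ) :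
    ∑ k, bmul (gradB Φ p k) (gradB Φ p k) = 0 ↔
      innC (gradC (fun z => (Φ z).1) p) (gradC (fun z => (Φ z).1) p) =
          innC (gradC (fun z => (Φ z).2) p) (gradC (fun z => (Φ z).2) p) ∧
        innC (gradC (fun z => (Φ z).1) p) (gradC (fun z => (Φ z).2) p) = 0 := by
  have h : ∀ a b : ℂ, a * b + b * a = 2 * (a * b) := fun a b => by ring
  simp [Prod.ext_iff, Prod.fst_sum, Prod.snd_sum, bmul, gradB, innC, gradC, h,
    Finset.sum_sub_distrib, ← Finset.mul_sum, sub_eq_zero]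

theorem isCHMB_iff {m : ℕ} {U : Set (Fin m → ℂ)} (hU : IsOpen U)
    {Φ : (Fin m → ℂ) → ℂ × ℂ} (hΦ : DifferentiableOn ℂ Φ U) :
    IsCHMB Φ U ↔
      ∀ p ∈ U,
        lapC (fun z => (Φ z).1) p = 0 ∧ lapC (fun z => (Φ z).2) p = 0 ∧
        innC (gradC (fun z => (Φ z).1) p) (gradC (fun z => (Φ z).1) p) =
          innC (gradC (fun z => (Φ z).2) p) (gradC (fun z => (Φ z).2) p) ∧
        innC (gradC (fun z => (Φ z).1) p) (gradC (fun z => (Φ z).2) p) = 0 := by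
  constructor
  · intro h p hp
    have hpull : ∀ f : ℂ × ℂ → ℂ, Differentiable ℂ f → (∀ w, lapB f w = 0) →
        lapC (f ∘ Φ) p = 0 := fun f hf hlap =>
      (h Set.univ isOpen_univ f ⟨hf.differentiableOn, fun w _ => hlap w⟩ ⟨p, hp, trivial⟩).2
        p ⟨hp, trivial⟩
    have hfst : ∀ w : ℂ × ℂ, fderiv ℂ (fun w : ℂ × ℂ => w.1) w = .fst ℂ ℂ ℂ :=
      fun w => fderiv_fst
    have hsnd : ∀ w : ℂ × ℂ, fderiv ℂ (fun w : ℂ × ℂ => w.2) w = .snd ℂ ℂ ℂ :=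
      fun w => fderiv_snd
    have h₁ : lapC (fun z => (Φ z).1) p = 0 :=
      hpull (fun w => w.1) differentiable_fst fun w => by simp [lapB, hfst]
    have h₂ : lapC (fun z => (Φ z).2) p = 0 :=
      hpull (fun w => w.2) differentiable_snd fun w => by simp [lapB, hsnd]
    have hmul : ∀ w v : ℂ × ℂ, fderiv ℂ (fun w : ℂ × ℂ => w.1 * w.2) w v =
        w.1 * v.2 + w.2 * v.1 := fun w v => by
      rw [fderiv_fun_mul differentiableAt_fst differentiableAt_snd]
      simp [hfst, hsnd]
    have hsq : ∀ w v : ℂ × ℂ, fderiv ℂ (fun w : ℂ × ℂ => w.1 * w.1 - w.2 * w.2) w v =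
        2 * v.1 * w.1 - 2 * v.2 * w.2 := fun w v => by
      rw [fderiv_fun_sub (by fun_prop) (by fun_prop),
        fderiv_fun_mul differentiableAt_fst differentiableAt_fst,
        fderiv_fun_mul differentiableAt_snd differentiableAt_snd]
      simp [hfst, hsnd]
      ring
    have hfst' : ∀ w : ℂ × ℂ, ∀ a : ℂ, fderiv ℂ (fun w : ℂ × ℂ => a * w.1) w =
        a • .fst ℂ ℂ ℂ := fun w a => by
      rw [fderiv_const_mul differentiableAt_fst, hfst]
    have hsnd' : ∀ w : ℂ × ℂ, ∀ a : ℂ, fderiv ℂ (fun w : ℂ × ℂ => a * w.2) w =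
        a • .snd ℂ ℂ ℂ := fun w a => by
      rw [fderiv_const_mul differentiableAt_snd, hsnd]
    have h₃ := hpull (fun w => w.1 * w.2) (by fun_prop) fun w => by
      simp [lapB, hmul, hfst, hsnd]
    have h₄ := hpull (fun w => w.1 * w.1 - w.2 * w.2) (by fun_prop) fun w => by
      simp [lapB, hsq, hfst', hsnd']
    rw [lapC_comp hU hΦ isOpen_univ (by fun_prop) hp trivial, h₁, h₂] at h₃ h₄
    simp only [hmul, hsq] at h₃ h₄
    refine ⟨h₁, h₂, ?_, ?_⟩
    · simp [hfst', hsnd'] at h₄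
      linear_combination h₄ / 2
    · simp [hfst, hsnd] at h₃
      linear_combination h₃
  · rintro h V hV f ⟨hf, hlap⟩ -
    refine ⟨hf.comp (hΦ.mono Set.inter_subset_left) fun z hz => hz.2, fun p ⟨hp, hpV⟩ => ?_⟩
    obtain ⟨h₁, h₂, h₃, h₄⟩ := h p hp
    have hlapp := hlap (Φ p) hpV
    rw [lapB] at hlapp
    rw [lapC_comp hU hΦ hV hf hp hpV, h₁, h₂, h₃, h₄]
    linear_combination
      innC (gradC (fun z => (Φ z).2) p) (gradC (fun z => (Φ z).2) p) * hlapp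

/-- a holomorphic map `Φ = Φ₁ + Φ₂ i₂ : U → 𝔹` on open `U ⊆ ℂ^m` is a
complex-harmonic morphism iff (a) `Σ_k ∂²Φ/∂z_k² = 0` and (b) `Σ_k (∂Φ/∂z_k)² = 0`
(squares in `𝔹`); equivalently iff `Δ_ℂ Φ₁ = Δ_ℂ Φ₂ = 0`,
`(grad_ℂ Φ₁)² = (grad_ℂ Φ₂)²` and `⟨grad_ℂ Φ₁, grad_ℂ Φ₂⟩_ℂ = 0`. -/
theorem chm_into_bicomplex_iff {m : ℕ} (U : Set (Fin m → ℂ)) (hU : IsOpen U)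
    (Φ : (Fin m → ℂ) → ℂ × ℂ) (hΦ : DifferentiableOn ℂ Φ U) :
    (IsCHMB Φ U ↔
      ∀ p ∈ U,
        (lapC (fun z => (Φ z).1) p = 0 ∧ lapC (fun z => (Φ z).2) p = 0) ∧
        ∑ k, bmul (gradB Φ p k) (gradB Φ p k) = 0) ∧
    (IsCHMB Φ U ↔
      ∀ p ∈ U,
        lapC (fun z => (Φ z).1) p = 0 ∧ lapC (fun z => (Φ z).2) p = 0 ∧
        innC (gradC (fun z => (Φ z).1) p) (gradC (fun z => (Φ z).1) p) =
          innC (gradC (fun z => (Φ z).2) p) (gradC (fun z => (Φ z).2) p) ∧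
        innC (gradC (fun z => (Φ z).1) p) (gradC (fun z => (Φ z).2) p) = 0) := by
  simp only [isCHMB_iff hU hΦ, sum_bmul_gradB_self_eq_zero_iff, and_assoc, and_self]
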